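/- arXiv:2105.15017 — 2 statements merged into one kernel-verified Lean document; each statement's English description precedes it below -/
import Mathlib

section
/- Let (Ω, 𝓕, P) be a probability space, (S_k)_{k≥1} a sequence of nonnegative measurable random variables on Ω, (δ_k)_{k≥1} a sequence of strictly positive real numbers with ∑_{k=1}^∞ δ_k = ∞ and ∑_{k=1}^∞ δ_k² < ∞, and C ≥ 0 a constant. Suppose that for every k ≥ 1 and every real s with 0 < s < δ_k one has P{ω : S_k(ω) < s} ≤ C s². Then for every t > 0, P{ω : ∑_{k=1}^∞ S_k(ω) < t} = 0 (equivalently, the supremum of the partial sums S_1 + ⋯ + S_p is ≥ t almost surely). -/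
open MeasureTheory Filter

/-- A non-summable series of nonnegative reals has infinite sum in `ℝ≥0∞`. -/
theorem tsum_ofReal_eq_top_of_not_summable {ι : Type*} {f : ι → ℝ} (hf : ∀ i, 0 ≤ f i)
    (h : ¬ Summable f) : ∑' i, ENNReal.ofReal (f i) = ⊤ := by
  by_contra hne
  exact h (by simpa only [ENNReal.toReal_ofReal (hf _)] using ENNReal.summable_toReal hne)

/-- Probabilistic core of the non-explosion theorem: if each nonnegative random
variable `S k` satisfies `P{S k < s} ≤ C s²` for `0 < s < δ k`, where `δ k > 0`,
`∑ δ k = ∞` and `∑ (δ k)² < ∞`, then for every `t > 0` the event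
`{∑ₖ S k < t}` has probability zero. -/
theorem sum_of_exit_times_infinite_of_weak_uniform_cover
    {Ω : Type*} [MeasurableSpace Ω] (P : Measure Ω) [IsProbabilityMeasure P]
    (S : ℕ → Ω → ℝ) (hS_meas : ∀ k, Measurable (S k))
    (hS_nonneg : ∀ k ω, 0 ≤ S k ω)
    (δ : ℕ → ℝ) (hδ_pos : ∀ k, 0 < δ k)
    (hδ_div : ¬ Summable δ) (hδ_sq : Summable (fun k => (δ k) ^ 2))
    (C : ℝ) (hC : 0 ≤ C)
    (hbound : ∀ k, ∀ s : ℝ, 0 < s → s < δ k →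
      P {ω | S k ω < s} ≤ ENNReal.ofReal (C * s ^ 2)) :
    ∀ t : ℝ, 0 < t →
      P {ω | ∑' k, ENNReal.ofReal (S k ω) < ENNReal.ofReal t} = 0 := by
  intro t _
  have hle : ∀ ε : ℝ, 0 < ε → ε < 1 →
      P {ω | ∑' k, ENNReal.ofReal (S k ω) < ENNReal.ofReal t} ≤
        ENNReal.ofReal (ε ^ 2 * (C * ∑' k, (δ k) ^ 2)) := by
    intro ε hε hε1
    have hsub : {ω | ∑' k, ENNReal.ofReal (S k ω) < ENNReal.ofReal t} ⊆
        ⋃ k, {ω | S k ω < ε * δ k} := by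
      intro ω hω
      by_contra hcon
      simp only [Set.mem_iUnion, Set.mem_ofPred_eq, not_exists, not_lt] at hcon
      have htop : ∑' k, ENNReal.ofReal (ε * δ k) = ⊤ :=
        tsum_ofReal_eq_top_of_not_summable (fun k => (mul_pos hε (hδ_pos k)).le)
          (by rwa [summable_mul_left_iff hε.ne'])
      have hmono : ∑' k, ENNReal.ofReal (ε * δ k) ≤ ∑' k, ENNReal.ofReal (S k ω) :=
        ENNReal.tsum_le_tsum fun k => ENNReal.ofReal_le_ofReal (hcon k)
      exact not_top_lt (htop ▸ hmono.trans_lt hω)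
    calc P {ω | ∑' k, ENNReal.ofReal (S k ω) < ENNReal.ofReal t}
        ≤ P (⋃ k, {ω | S k ω < ε * δ k}) := measure_mono hsub
      _ ≤ ∑' k, P {ω | S k ω < ε * δ k} := measure_iUnion_le _
      _ ≤ ∑' k, ENNReal.ofReal (ε ^ 2 * (C * (δ k) ^ 2)) :=
          ENNReal.tsum_le_tsum fun k =>
            (hbound k _ (mul_pos hε (hδ_pos k)) (mul_lt_of_lt_one_left (hδ_pos k) hε1)).trans_eq
              (by congr 1; ring)
      _ = ENNReal.ofReal (ε ^ 2 * (C * ∑' k, (δ k) ^ 2)) := by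
          rw [← ENNReal.ofReal_tsum_of_nonneg (fun k => by positivity)
            ((hδ_sq.mul_left C).mul_left _), tsum_mul_left, tsum_mul_left]
  have hlim : Tendsto (fun ε : ℝ => ENNReal.ofReal (ε ^ 2 * (C * ∑' k, (δ k) ^ 2)))
      (nhdsWithin 0 (Set.Ioi 0)) (nhds 0) := by
    have hcont : Continuous fun ε : ℝ => ENNReal.ofReal (ε ^ 2 * (C * ∑' k, (δ k) ^ 2)) :=
      ENNReal.continuous_ofReal.comp (by fun_prop)
    simpa using (hcont.tendsto 0).mono_left nhdsWithin_le_nhds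
  refine le_antisymm (ge_of_tendsto hlim ?_) zero_le
  filter_upwards [Ioo_mem_nhdsGT (zero_lt_one (α := ℝ))] with ε hε
  exact hle ε hε.1 hε.2
end

section
/- Let (Ω, 𝓕, P) be a probability space, (S_k)_{k≥1} a sequence of nonnegative measurable random variables on Ω, δ > 0, and (C_k)_{k≥1} a sequence of nonnegative constants such that lim_{p→∞} (1/p²) ∑_{k=1}^p C_k = 0. Suppose that for every k ≥ 1 and every real s with 0 < s < δ one has P{ω : S_k(ω) < s} ≤ C_k s². Then for every t > 0, P{ω : ∑_{k=1}^∞ S_k(ω) < t} = 0. -/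
open MeasureTheory Filter

/-- If the sum of nonnegative terms is less than `t`, one of the first `p` terms is less
than `t / p`. -/
lemma exists_lt_div_of_tsum_ofReal_lt {a : ℕ → ℝ} {t : ℝ} {p : ℕ} (hp : 0 < p)
    (h : ∑' k, ENNReal.ofReal (a k) < ENNReal.ofReal t) :
    ∃ k ∈ Finset.range p, a k < t / p := by
  by_contra! hge
  have hp' : (p : ℝ) ≠ 0 := by positivity
  refine h.not_ge ?_
  calc ENNReal.ofReal t = ∑ _k ∈ Finset.range p, ENNReal.ofReal (t / p) := by
        rw [Finset.sum_const, Finset.card_range, ← ENNReal.ofReal_nsmul, nsmul_eq_mul,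
          mul_div_cancel₀ t hp']
    _ ≤ ∑ k ∈ Finset.range p, ENNReal.ofReal (a k) :=
        Finset.sum_le_sum fun k hk => ENNReal.ofReal_le_ofReal (hge k hk)
    _ ≤ ∑' k, ENNReal.ofReal (a k) := ENNReal.sum_le_tsum _

/-- Non-explosion with varying constants: if each nonnegative random variable `S k`
satisfies `P{S k < s} ≤ C k · s²` for `0 < s < δ`, with `δ > 0` fixed and the
constants `C k ≥ 0` satisfying `(1/p²) ∑_{k<p} C k → 0`, then for every `t > 0`
the event `{∑ₖ S k < t}` has probability zero. -/
theorem sum_of_exit_times_infinite_of_slowly_growing_constants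
    {Ω : Type*} [MeasurableSpace Ω] (P : Measure Ω) [IsProbabilityMeasure P]
    (S : ℕ → Ω → ℝ) (hS_meas : ∀ k, Measurable (S k))
    (hS_nonneg : ∀ k ω, 0 ≤ S k ω)
    (δ : ℝ) (hδ : 0 < δ)
    (C : ℕ → ℝ) (hC : ∀ k, 0 ≤ C k)
    (hC_slow : Tendsto (fun p : ℕ => (∑ k ∈ Finset.range p, C k) / (p : ℝ) ^ 2)
      atTop (nhds 0))
    (hbound : ∀ k, ∀ s : ℝ, 0 < s → s < δ →
      P {ω | S k ω < s} ≤ ENNReal.ofReal (C k * s ^ 2)) :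
    ∀ t : ℝ, 0 < t →
      P {ω | ∑' k, ENNReal.ofReal (S k ω) < ENNReal.ofReal t} = 0 := by
  intro t ht
  have hlim : Tendsto (fun p : ℕ =>
      ENNReal.ofReal (t ^ 2 * ((∑ k ∈ Finset.range p, C k) / (p : ℝ) ^ 2))) atTop (nhds 0) := by
    simpa using ENNReal.tendsto_ofReal (hC_slow.const_mul (t ^ 2))
  refine le_antisymm (ge_of_tendsto hlim ?_) bot_le
  filter_upwards [(tendsto_const_div_atTop_nhds_zero_nat t).eventually_lt_const hδ,
    eventually_gt_atTop 0] with p hpδ hp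
  have htp : 0 < t / p := by positivity
  calc P {ω | ∑' k, ENNReal.ofReal (S k ω) < ENNReal.ofReal t}
      ≤ P (⋃ k ∈ Finset.range p, {ω | S k ω < t / p}) := by
        refine measure_mono fun ω hω => ?_
        simpa only [Set.mem_iUnion, Set.mem_ofPred_eq, exists_prop] using
          exists_lt_div_of_tsum_ofReal_lt hp hω
    _ ≤ ∑ k ∈ Finset.range p, P {ω | S k ω < t / p} := measure_biUnion_finset_le _ _
    _ ≤ ∑ k ∈ Finset.range p, ENNReal.ofReal (C k * (t / p) ^ 2) :=
        Finset.sum_le_sum fun k _ => hbound k _ htp hpδ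
    _ = ENNReal.ofReal (t ^ 2 * ((∑ k ∈ Finset.range p, C k) / (p : ℝ) ^ 2)) := by
        rw [← ENNReal.ofReal_sum_of_nonneg fun k _ => mul_nonneg (hC k) (sq_nonneg _),
          ← Finset.sum_mul]
        ring_nf
end
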